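/- Let (F,g) be a one-dimensional figure with weights such that F ⊆ ℕ and 0 ∈ F. If there exist a finite alphabet A and a non-constant word w : ℤ → A with abelian pattern complexity 1 over (F,g), then there exists an integer n ≥ 1 such that the n-th cyclotomic polynomial Φ_n divides Poly(X) = ∑_{x ∈ F} g(x)·X^x in ℚ[X]. -/

import Mathlib

open Polynomial in
/-- A polynomial over a field of characteristic zero that is divisible by no cyclotomic polynomial
is coprime to `X ^ N - 1`. -/
theorem isCoprime_X_pow_sub_one_of_not_cyclotomic_dvd {P : ℚ[X]} {N : ℕ} (hN : 0 < N)
    (h : ∀ n : ℕ, 1 ≤ n → ¬ cyclotomic n ℚ ∣ P) : IsCoprime (X ^ N - 1) P := by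
  rw [← prod_cyclotomic_eq_X_pow_sub_one hN]
  refine IsCoprime.prod_left fun n hn => ?_
  have hn := Nat.pos_of_mem_divisors hn
  exact ((cyclotomic.irreducible_rat hn).coprime_iff_not_dvd).2 (h n hn)

/-- The shift operator on bi-infinite rational sequences. -/
def seqShift : Module.End ℚ (ℤ → ℚ) := LinearMap.funLeft ℚ ℚ (fun t => t + 1)

theorem seqShift_pow_apply (n : ℕ) (f : ℤ → ℚ) (t : ℤ) : (seqShift ^ n) f t = f (t + n) := by
  induction n generalizing t with
  | zero => simp
  | succ n ih =>
    rw [pow_succ', Module.End.mul_apply]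
    change (seqShift ^ n) f (t + 1) = _
    rw [ih]
    push_cast
    congr 1
    ring

open Polynomial in
/-- A bi-infinite sequence annihilated by two coprime polynomials in the shift vanishes. -/
theorem eq_zero_of_isCoprime_aeval_seqShift {P Q : ℚ[X]} (h : IsCoprime P Q) {f : ℤ → ℚ}
    (hP : aeval seqShift P f = 0) (hQ : aeval seqShift Q f = 0) : f = 0 := by
  obtain ⟨a, b, hab⟩ := h
  have := congrArg (fun R : ℚ[X] => aeval seqShift R f) hab
  simpa [hP, hQ] using this.symm

/-- A bi-infinite solution of a linear recurrence with nonzero extreme coefficients vanishes as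
soon as it vanishes on a window of the length of the recurrence. -/
theorem eq_zero_of_recurrence_of_window {F : Finset ℤ} {g : ℤ → ℚ} {d : ℤ}
    (hF : ∀ x ∈ F, 0 ≤ x ∧ x ≤ d) (h0F : 0 ∈ F) (hdF : d ∈ F) (hg0 : g 0 ≠ 0) (hgd : g d ≠ 0)
    {v : ℤ → ℚ} (hv : ∀ t, ∑ x ∈ F, g x * v (x + t) = 0)
    {i : ℤ} (hi : ∀ k, 0 ≤ k → k < d → v (k + i) = 0) : v = 0 := by
  have key : ∀ t, ∀ k, 0 ≤ k → k < d → v (k + t) = 0 := by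
    intro t
    induction t using Int.inductionOn' (b := i) with
    | zero => exact hi
    | succ t _ ih =>
      intro k hk0 hkd
      rcases lt_or_eq_of_le (show k + 1 ≤ d by omega) with h | h
      · rw [show k + (t + 1) = (k + 1) + t by ring]
        exact ih _ (by omega) h
      · have hs := hv t
        rw [Finset.sum_eq_single_of_mem d hdF fun x hx hxd => by
          rw [ih x (hF x hx).1 (lt_of_le_of_ne (hF x hx).2 hxd), mul_zero]] at hs
        rw [show k + (t + 1) = d + t by omega]
        exact (mul_eq_zero.1 hs).resolve_left hgd
    | pred t _ ih =>
      intro k hk0 hkd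
      rcases lt_or_eq_of_le hk0 with h | h
      · rw [show k + (t - 1) = (k - 1) + t by ring]
        exact ih _ (by omega) (by omega)
      · have hs := hv (t - 1)
        rw [Finset.sum_eq_single_of_mem 0 h0F fun x hx hx0 => by
          have := hF x hx
          rw [show x + (t - 1) = (x - 1) + t by ring, ih (x - 1) (by omega) (by omega),
            mul_zero]] at hs
        rw [← h]
        exact (mul_eq_zero.1 hs).resolve_left hg0
  funext t
  have hd := (hF 0 h0F).2
  rcases lt_or_eq_of_le hd with h | h
  · simpa using key t 0 le_rfl h
  · have hs := hv t
    rw [Finset.sum_eq_single_of_mem 0 h0F fun x hx hx0 => by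
      have := hF x hx
      omega] at hs
    simpa [hg0] using hs

/-- A sequence with finitely many values whose weighted sums over translates of `F` are constant
is periodic. -/
theorem exists_period_of_constant_sums {F : Finset ℤ} {g : ℤ → ℚ}
    (hF : ∀ x ∈ F, 0 ≤ x) (h0F : 0 ∈ F) (hg : ∀ x ∈ F, g x ≠ 0)
    {u : ℤ → ℚ} (hfin : (Set.range u).Finite)
    (hu : ∀ t t', ∑ x ∈ F, g x * u (x + t) = ∑ x ∈ F, g x * u (x + t')) :
    ∃ N : ℕ, 0 < N ∧ ∀ t, u (t + N) = u t := by
  set d := F.max' ⟨0, h0F⟩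
  have hdF : d ∈ F := F.max'_mem _
  have : Finite (Set.range u) := hfin
  obtain ⟨i, j, hij, heq⟩ := Finite.exists_ne_map_eq_of_infinite
    (fun (t : ℤ) (k : Fin d.toNat) => (⟨u (k + t), Set.mem_range_self _⟩ : Set.range u))
  have hper : (fun t => u (t + (j - i)) - u t) = 0 := by
    refine eq_zero_of_recurrence_of_window (d := d) (i := i)
      (fun x hx => ⟨hF x hx, F.le_max' x hx⟩) h0F hdF (hg 0 h0F) (hg d hdF) (fun t => ?_) ?_
    · simp only [mul_sub, Finset.sum_sub_distrib, add_assoc]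
      rw [hu _ t, sub_self]
    · intro k hk0 hkd
      have := congrArg Subtype.val (congrFun heq ⟨k.toNat, by omega⟩)
      simp only [Int.toNat_of_nonneg hk0] at this
      rw [show k + i + (j - i) = k + j by ring, this, sub_self]
  have hper' : ∀ t, u (t + (j - i)) = u t := fun t => sub_eq_zero.1 (congrFun hper t)
  refine ⟨(j - i).natAbs, by omega, fun t => ?_⟩
  rcases Int.natAbs_eq (j - i) with h | h
  · rw [← h, hper']
  · rw [← hper' (t + _)]
    congr 1
    omega

/-- Let (F,g) be a one-dimensional figure with weights with F ⊆ ℕ and 0 ∈ F.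
If there exist a finite alphabet A and a non-constant word w : ℤ → A with abelian pattern
complexity 1 over (F,g), then there exists n ≥ 1 such that the n-th cyclotomic polynomial
divides Poly(X) = ∑_{x ∈ F} g(x)·X^x in ℚ[X]. -/
theorem stmt4 (F : Finset ℤ) (hF : F.Nonempty) (g : ℤ → ℤ)
    (hg : ∀ x : ℤ, x ∈ F ↔ g x ≠ 0)
    (hFnat : ∀ x ∈ F, (0 : ℤ) ≤ x) (h0F : (0 : ℤ) ∈ F)
    (A : Type*) [Fintype A] [DecidableEq A] (w : ℤ → A)
    (hnc : ¬ ∀ i j : ℤ, w i = w j)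
    (hcomp : ∀ (a : A) (t t' : ℤ),
      ∑ x ∈ F.filter (fun x => w (x + t) = a), g x =
      ∑ x ∈ F.filter (fun x => w (x + t') = a), g x) :
    ∃ n : ℕ, 1 ≤ n ∧ Polynomial.cyclotomic n ℚ ∣
      Polynomial.map (Int.castRingHom ℚ)
        (∑ x ∈ F, Polynomial.C (g x) * Polynomial.X ^ x.toNat) := by
  by_contra hcon
  push Not at hcon hnc
  obtain ⟨i, j, hij⟩ := hnc
  set P := Polynomial.map (Int.castRingHom ℚ)
    (∑ x ∈ F, Polynomial.C (g x) * Polynomial.X ^ x.toNat) with hPdef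
  set u : ℤ → ℚ := fun t => if w t = w i then 1 else 0 with hudef
  have hu : ∀ t t', ∑ x ∈ F, (g x : ℚ) * u (x + t) = ∑ x ∈ F, (g x : ℚ) * u (x + t') := by
    intro t t'
    have := congrArg (Int.cast : ℤ → ℚ) (hcomp (w i) t t')
    simpa [hudef, Finset.sum_filter] using this
  have hfin : (Set.range u).Finite := by
    refine (Set.toFinite {0, 1}).subset ?_
    rintro _ ⟨t, rfl⟩
    by_cases h : w t = w i <;> simp [hudef, h]
  obtain ⟨N, hN, hper⟩ := exists_period_of_constant_sums (g := fun x => (g x : ℚ)) hFnat h0F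
    (fun x hx => Int.cast_ne_zero.2 ((hg x).1 hx)) hfin hu
  have hdiff : (fun t => u (t + 1) - u t) = 0 := by
    refine eq_zero_of_isCoprime_aeval_seqShift
      (isCoprime_X_pow_sub_one_of_not_cyclotomic_dvd hN hcon) ?_ ?_
    · funext t
      simp [seqShift_pow_apply, add_right_comm t (N : ℤ) 1, hper]
    · funext t
      have hsum : Polynomial.aeval seqShift P (fun t => u (t + 1) - u t) t
          = ∑ x ∈ F, (g x : ℚ) * (u (x + (t + 1)) - u (x + t)) := by
        simp only [hPdef, Polynomial.map_sum, Polynomial.map_mul, Polynomial.map_pow,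
          Polynomial.map_C, Polynomial.map_X, map_sum, map_mul, map_pow, Polynomial.aeval_C,
          Polynomial.aeval_X, LinearMap.sum_apply, Finset.sum_apply]
        refine Finset.sum_congr rfl fun x hx => ?_
        rw [Module.End.mul_apply, Module.algebraMap_end_apply, Pi.smul_apply,
          seqShift_pow_apply, Int.toNat_of_nonneg (hFnat x hx), smul_eq_mul,
          show t + x + 1 = x + (t + 1) by ring, add_comm t x]
        rfl
      rw [hsum]
      simp only [mul_sub, Finset.sum_sub_distrib]
      rw [hu (t + 1) t, sub_self]
      rfl
  have hstep : Function.Periodic u 1 := fun t => sub_eq_zero.1 (congrFun hdiff t)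
  have hconst : ∀ t, u t = u 0 := fun t => by simpa using hstep.int_mul t 0
  have hui : u i = u j := (hconst i).trans (hconst j).symm
  simp [hudef, Ne.symm hij] at hui
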